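/- Let G be a connected proper interval graph on {1,…,n}, let C be a positive integer, and suppose ω(G) = kC + r where k = ⌊(ω(G)−1)/C⌋ and 2 ≤ r ≤ C. Then G has a [k+1, C]-block partition if and only if no C consecutive vertices of {1,…,n} are all forbidden (i.e., the set F of forbidden vertices contains no block of size C). -/

import Mathlib

/-- Reachability inside a set `S`: there is a walk from `u` to `v` all of whose
vertices lie in `S`. -/
def ReachIn {α : Type*} (G : SimpleGraph α) (S : Set α) (u v : α) : Prop :=
  Relation.ReflTransGen (fun a b => G.Adj a b ∧ a ∈ S ∧ b ∈ S) u v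

/-- The subgraph induced by `S` is connected. -/
def ConnectedIn {α : Type*} (G : SimpleGraph α) (S : Set α) : Prop :=
  ∀ u ∈ S, ∀ v ∈ S, ReachIn G S u v

/-- `G` is a graph on the vertex set `{1,…,n}`. -/
def OnRange (n : ℕ) (G : SimpleGraph ℕ) : Prop :=
  ∀ u v : ℕ, G.Adj u v → u ∈ Set.Icc 1 n ∧ v ∈ Set.Icc 1 n

/-- The umbrella property characterising proper interval graphs. -/
def Umbrella (G : SimpleGraph ℕ) : Prop :=
  ∀ u v w : ℕ, u < v → v < w → G.Adj u w → G.Adj u v ∧ G.Adj v w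

/-- `Ps` is a partition of the vertex set `{1,…,n}`. -/
def IsPartitionOf (n : ℕ) (Ps : Set (Set ℕ)) : Prop :=
  (∀ P ∈ Ps, P.Nonempty) ∧ Ps.PairwiseDisjoint id ∧ ⋃₀ Ps = Set.Icc 1 n

/-- A `[λ,C]`-partition of the graph `G` on `{1,…,n}`: every part induces a
connected subgraph, every part has at most `C` vertices, and every clique
meets at most `L` parts. -/
def IsLCPartition (n : ℕ) (G : SimpleGraph ℕ) (L C : ℕ) (Ps : Set (Set ℕ)) : Prop :=
  IsPartitionOf n Ps ∧ (∀ P ∈ Ps, ConnectedIn G P ∧ P.ncard ≤ C) ∧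
    ∀ K : Set ℕ, G.IsClique K → {P ∈ Ps | (P ∩ K).Nonempty}.ncard ≤ L

/-- A block: a set of consecutive vertices `{u, u+1, …, v}` with `1 ≤ u ≤ v`. -/
def IsBlockSet (P : Set ℕ) : Prop := ∃ u v : ℕ, 1 ≤ u ∧ u ≤ v ∧ P = Set.Icc u v

/-- A `[λ,C]`-block partition: a `[λ,C]`-partition all of whose parts are blocks. -/
def IsLCBlockPartition (n : ℕ) (G : SimpleGraph ℕ) (L C : ℕ) (Ps : Set (Set ℕ)) : Prop :=
  IsLCPartition n G L C Ps ∧ ∀ P ∈ Ps, IsBlockSet P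

/-- A `[λ,C]`-coloring of the graph `G` on `{1,…,n}` with colors `Fin L`:
every monochromatic component has at most `C` vertices. -/
def IsLCColoring (n : ℕ) (G : SimpleGraph ℕ) (C : ℕ) {L : ℕ} (c : ℕ → Fin L) : Prop :=
  ∀ v ∈ Set.Icc 1 n, {u | ReachIn G {w | c w = c v} v u}.ncard ≤ C

/-- The clique number of `G`. -/
noncomputable def cliqueNumber (G : SimpleGraph ℕ) : ℕ :=
  sSup {m | ∃ s : Finset ℕ, G.IsNClique m s}

/-- The graph `G` on `{1,…,n}` is connected. -/
def ConnectedOn (n : ℕ) (G : SimpleGraph ℕ) : Prop :=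
  ConnectedIn G (Set.Icc 1 n)

/-- The set of forbidden vertices: the least set containing all primarily
forbidden vertices and closed under the secondary rule. -/
inductive Forbidden (n : ℕ) (G : SimpleGraph ℕ) (C k : ℕ) : ℕ → Prop
  | primary (i : ℕ) : k * C < i → i + 1 ≤ n →
      G.IsClique (Set.Icc (i - k * C) (i + 1)) → Forbidden n G C k i
  | secondary (v s q : ℕ) : 1 ≤ s → s + 1 ≤ C → 1 ≤ q → q ≤ k →
      (∀ w ∈ Set.Icc (v - s + 1) v, Forbidden n G C k w) →
      k * C < v → G.IsClique (Set.Icc (v - k * C) (v - s + 1)) →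
      Forbidden n G C k (v - q * C)

/-- `v` is a leader: for some `1 ≤ s ≤ C-1` the block `[v-s+1, v]` consists of
forbidden vertices and the block `[v-kC, v-s+1]` is a clique. -/
def IsLeader (n : ℕ) (G : SimpleGraph ℕ) (C k : ℕ) (v : ℕ) : Prop :=
  ∃ s : ℕ, 1 ≤ s ∧ s + 1 ≤ C ∧ (∀ w ∈ Set.Icc (v - s + 1) v, Forbidden n G C k w) ∧
    k * C < v ∧ G.IsClique (Set.Icc (v - k * C) (v - s + 1))

theorem Umbrella.adj_of_le {G : SimpleGraph ℕ} (humb : Umbrella G) {u x y w : ℕ}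
    (h : G.Adj u w) (hux : u ≤ x) (hxy : x < y) (hyw : y ≤ w) : G.Adj x y := by
  have hxw : G.Adj x w := by
    rcases hux.eq_or_lt with rfl | hux
    · exact h
    · exact (humb u x w hux (hxy.trans_le hyw) h).2
  rcases hyw.eq_or_lt with rfl | hyw
  · exact hxw
  · exact (humb x y w hxy hyw hxw).1

theorem Umbrella.isClique_Icc {G : SimpleGraph ℕ} (humb : Umbrella G) {u w : ℕ}
    (h : G.Adj u w) : G.IsClique (Set.Icc u w) := by
  intro x hx y hy hne
  rcases hne.lt_or_gt with hlt | hlt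
  · exact humb.adj_of_le h hx.1 hlt hy.2
  · exact (humb.adj_of_le h hy.1 hlt hx.2).symm

theorem ReachIn.exists_adj_crossing {G : SimpleGraph ℕ} {S : Set ℕ} {u v i : ℕ}
    (h : ReachIn G S u v) (hu : u ≤ i) (hv : i < v) :
    ∃ a b, a ≤ i ∧ i < b ∧ G.Adj a b := by
  induction h with
  | refl => omega
  | @tail b c _ hbc ih =>
    by_cases hb : i < b
    · exact ih hb
    · exact ⟨b, c, by omega, hv, hbc.1⟩

theorem ConnectedOn.adj_succ {n : ℕ} {G : SimpleGraph ℕ} (hconn : ConnectedOn n G)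
    (humb : Umbrella G) {i : ℕ} (hi : 1 ≤ i) (hin : i < n) : G.Adj i (i + 1) := by
  obtain ⟨a, b, ha, hb, hab⟩ :=
    (hconn i ⟨hi, hin.le⟩ (i + 1) ⟨by omega, hin⟩).exists_adj_crossing le_rfl i.lt_succ_self
  exact humb.adj_of_le hab ha i.lt_succ_self hb

theorem connectedIn_Icc {G : SimpleGraph ℕ} {a b : ℕ}
    (h : ∀ i, a ≤ i → i < b → G.Adj i (i + 1)) : ConnectedIn G (Set.Icc a b) := by
  have key : ∀ v, a ≤ v → v ≤ b →
      ReachIn G (Set.Icc a b) a v ∧ ReachIn G (Set.Icc a b) v a := by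
    intro v hav
    induction v, hav using Nat.le_induction with
    | base => exact fun _ => ⟨.refl, .refl⟩
    | succ v hav ih =>
      intro hvb
      obtain ⟨h1, h2⟩ := ih (by omega)
      have hadj := h v hav hvb
      have hv : v ∈ Set.Icc a b := ⟨hav, by omega⟩
      have hv' : v + 1 ∈ Set.Icc a b := ⟨by omega, hvb⟩
      exact ⟨.tail h1 ⟨hadj, hv, hv'⟩, .head ⟨hadj.symm, hv', hv⟩ h2⟩
  intro u hu v hv
  exact (key u hu.1 hu.2).2.trans (key v hv.1 hv.2).1

theorem Forbidden.lt {n : ℕ} {G : SimpleGraph ℕ} {C k x : ℕ} (h : Forbidden n G C k x) :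
    x < n := by
  induction h with
  | primary i _ hi _ => exact hi
  | secondary v s q hs _ _ _ _ hv _ ih =>
    have := ih v ⟨by omega, le_rfl⟩
    omega

theorem Forbidden.pos {n : ℕ} {G : SimpleGraph ℕ} {C k x : ℕ} (h : Forbidden n G C k x) :
    0 < x := by
  cases h with
  | primary _ hi _ _ => omega
  | secondary v s q _ _ _ hq _ hv _ =>
    have := Nat.mul_le_mul_right C hq
    omega

/-- `x` is the last vertex of a block belonging to `Ps`. -/
def IsPartEnd (Ps : Set (Set ℕ)) (x : ℕ) : Prop := ∃ u ≤ x, Set.Icc u x ∈ Ps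

theorem IsLCBlockPartition.exists_mem {n : ℕ} {G : SimpleGraph ℕ} {L C : ℕ}
    {Ps : Set (Set ℕ)} (hP : IsLCBlockPartition n G L C Ps) {a : ℕ} (ha : 1 ≤ a) (han : a ≤ n) :
    ∃ P ∈ Ps, a ∈ P := by
  have : a ∈ ⋃₀ Ps := by rw [hP.1.1.2.2]; exact ⟨ha, han⟩
  exact this

theorem IsLCBlockPartition.exists_isPartEnd {n : ℕ} {G : SimpleGraph ℕ} {L C : ℕ}
    {Ps : Set (Set ℕ)} (hP : IsLCBlockPartition n G L C Ps) {a : ℕ} (ha : 1 ≤ a) (han : a ≤ n) :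
    ∃ x, a ≤ x ∧ x < a + C ∧ IsPartEnd Ps x := by
  obtain ⟨P, hPs, haP⟩ := hP.exists_mem ha han
  obtain ⟨u, v, _, huv, rfl⟩ := hP.2 P hPs
  have hcard := (hP.1.2.1 _ hPs).2
  rw [← Finset.coe_Icc, Set.ncard_coe_finset, Nat.card_Icc] at hcard
  obtain ⟨hua, hav⟩ := haP
  exact ⟨v, hav, by omega, u, huv, hPs⟩

/-- A clique cannot contain more than `L - 1` part ends followed by another vertex. -/
theorem IsLCBlockPartition.not_isClique_of_ends {n : ℕ} {G : SimpleGraph ℕ} {k C : ℕ}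
    {Ps : Set (Set ℕ)} (hP : IsLCBlockPartition n G (k + 1) C Ps) {u w : ℕ}
    (hu : 1 ≤ u) (hw : w ≤ n) (f : ℕ → ℕ) (hend : ∀ t ≤ k, IsPartEnd Ps (f t))
    (hmono : ∀ t < k, f t < f (t + 1)) (h0 : u ≤ f 0) (hlast : f k < w) :
    ¬ G.IsClique (Set.Icc u w) := by
  intro hK
  have hfin : Ps.Finite := by
    refine (Set.finite_Icc 1 n).finite_subsets.subset fun P hPs => ?_
    rw [Set.mem_ofPred_eq, ← hP.1.1.2.2]
    exact Set.subset_sUnion_of_mem hPs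
  let g : ℕ → ℕ := fun t => if t ≤ k then f t else w
  have hg : ∀ s t, s < t → t ≤ k + 1 → g s < g t := by
    intro s t hst
    induction t, hst using Nat.le_induction with
    | base =>
      intro ht
      simp only [g]
      rcases Nat.lt_or_ge s k with h | h
      · rw [if_pos (by omega), if_pos (by omega)]; exact hmono s h
      · rw [if_pos (by omega), if_neg (by omega), show s = k by omega]; exact hlast
    | succ t hst ih =>
      intro ht
      refine (ih (by omega)).trans ?_
      simp only [g]
      rcases Nat.lt_or_ge t k with h | h
      · rw [if_pos (by omega), if_pos (by omega)]; exact hmono t h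
      · rw [if_pos (by omega), if_neg (by omega), show t = k by omega]; exact hlast
  have hgu : ∀ t ≤ k + 1, u ≤ g t := by
    intro t ht
    have h0' : u ≤ g 0 := by simpa [g] using h0
    rcases Nat.eq_zero_or_pos t with rfl | h
    · exact h0'
    · exact h0'.trans (hg 0 t h ht).le
  have hgw : ∀ t ≤ k + 1, g t ≤ w := by
    intro t ht
    have hw' : g (k + 1) = w := by simp [g]
    rcases ht.eq_or_lt with rfl | h
    · exact hw'.le
    · exact (hg t _ h le_rfl).le.trans hw'.le
  have hpart : ∀ t, ∃ P, t ≤ k + 1 → P ∈ Ps ∧ g t ∈ P := by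
    intro t
    by_cases ht : t ≤ k + 1
    · obtain ⟨P, h⟩ := hP.exists_mem (hu.trans (hgu t ht)) ((hgw t ht).trans hw)
      exact ⟨P, fun _ => h⟩
    · exact ⟨∅, fun h => absurd h ht⟩
  choose Q hQ using hpart
  have hne : ∀ s t, s < t → t ≤ k + 1 → Q s ≠ Q t := by
    intro s t hst ht heq
    obtain ⟨x, hx, hxP⟩ := hend s (by omega)
    have hgs : g s = f s := if_pos (by omega)
    have hQs : Q s = Set.Icc x (f s) := by
      by_contra hdis
      have := hP.1.1.2.1 (hQ s (by omega)).1 hxP hdis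
      exact Set.disjoint_left.1 this (hQ s (by omega)).2 ⟨hgs ▸ hx, hgs.le⟩
    have hmem := (hQ t ht).2
    rw [← heq, hQs] at hmem
    have := hg s t hst ht
    have := hmem.2
    omega
  have hinj : Set.InjOn Q (Finset.range (k + 2) : Set ℕ) := by
    intro s hs t ht heq
    simp only [Finset.coe_range, Set.mem_Iio] at hs ht
    rcases lt_trichotomy s t with h | h | h
    · exact absurd heq (hne s t h (by omega))
    · exact h
    · exact absurd heq.symm (hne t s h (by omega))
  have hle := hP.1.2.2 _ hK
  have hsub : Q '' (Finset.range (k + 2) : Set ℕ) ⊆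
      {P ∈ Ps | (P ∩ Set.Icc u w).Nonempty} := by
    rintro _ ⟨t, ht, rfl⟩
    simp only [Finset.coe_range, Set.mem_Iio] at ht
    have ht' : t ≤ k + 1 := by omega
    exact ⟨(hQ t ht').1, g t, (hQ t ht').2, hgu t ht', hgw t ht'⟩
  have hcard := Set.ncard_le_ncard hsub (hfin.subset (Set.sep_subset _ _))
  rw [hinj.ncard_image, Set.ncard_coe_finset, Finset.card_range] at hcard
  omega

/-- If `b + d * C` is a part end, then the block `[b, b + k * C]` contains `k + 1` part ends, so a
vertex following all of them cannot be in a common clique with `b`. -/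
theorem IsLCBlockPartition.not_isPartEnd {n : ℕ} {G : SimpleGraph ℕ} {k C : ℕ}
    {Ps : Set (Set ℕ)} (hP : IsLCBlockPartition n G (k + 1) C Ps) {b d w : ℕ}
    (hb : 1 ≤ b) (hd : d ≤ k) (hbn : b + k * C ≤ n) (hw : w ≤ n)
    (hends : ∀ x, x ≤ b + k * C → IsPartEnd Ps x → x < w)
    (hK : G.IsClique (Set.Icc b w)) : ¬ IsPartEnd Ps (b + d * C) := by
  intro hx
  have hwin : ∀ t, ∃ y, t ≤ k → IsPartEnd Ps y ∧ (t < d → b + t * C ≤ y ∧ y < b + t * C + C) ∧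
      (t = d → y = b + t * C) ∧ (d < t → b + t * C < y + C ∧ y ≤ b + t * C) := by
    intro t
    by_cases ht : t ≤ k
    swap
    · exact ⟨0, fun h => absurd h ht⟩
    have htC := Nat.mul_le_mul_right C ht
    rcases lt_trichotomy t d with h | rfl | h
    · obtain ⟨y, h1, h2, h3⟩ := hP.exists_isPartEnd (a := b + t * C) (by omega) (by omega)
      exact ⟨y, fun _ => ⟨h3, fun _ => ⟨h1, h2⟩, fun _ => by omega, fun _ => by omega⟩⟩
    · exact ⟨_, fun _ => ⟨hx, fun _ => by omega, fun _ => rfl, fun _ => by omega⟩⟩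
    · obtain ⟨t, rfl⟩ : ∃ t', t = t' + 1 := ⟨t - 1, by omega⟩
      rw [Nat.succ_mul] at *
      by_cases hC : C = 0
      · obtain ⟨y, h1, h2, h3⟩ := hP.exists_isPartEnd hb (by omega)
        omega
      obtain ⟨y, h1, h2, h3⟩ := hP.exists_isPartEnd (a := b + t * C + 1) (by omega) (by omega)
      exact ⟨y, fun _ => ⟨h3, fun _ => by omega, fun _ => by omega,
        fun _ => ⟨by omega, by omega⟩⟩⟩
  choose f hf using hwin
  refine hP.not_isClique_of_ends hb hw f (fun t ht => (hf t ht).1) ?_ ?_ ?_ hK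
  · intro t ht
    obtain ⟨-, h1, h2, h3⟩ := hf t (by omega)
    obtain ⟨-, h4, h5, h6⟩ := hf (t + 1) (by omega)
    rw [Nat.succ_mul] at h4 h5 h6
    rcases lt_trichotomy t d with h | h | h
    · rcases Nat.lt_or_ge (t + 1) d with h' | h'
      · have := h1 h; have := h4 h'; omega
      · have := h1 h; have := h5 (by omega); omega
    · have := h2 h; have := h6 (by omega); omega
    · have := h3 h; have := h6 (by omega); omega
  · obtain ⟨-, h1, h2, -⟩ := hf 0 (by omega)
    rcases Nat.eq_zero_or_pos d with h | h
    · have := h2 h.symm; omega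
    · have := h1 h; omega
  · obtain ⟨he, -, h2, h3⟩ := hf k le_rfl
    refine hends _ ?_ he
    rcases hd.eq_or_lt with h | h
    · exact (h2 h.symm).le
    · exact (h3 h).2

theorem Forbidden.not_isPartEnd {n : ℕ} {G : SimpleGraph ℕ} {C k x : ℕ}
    (h : Forbidden n G C k x) {Ps : Set (Set ℕ)} (hP : IsLCBlockPartition n G (k + 1) C Ps) :
    ¬ IsPartEnd Ps x := by
  induction h with
  | primary i hi hin hK =>
    have := hP.not_isPartEnd (b := i - k * C) (d := k) (w := i + 1) (by omega) le_rfl (by omega)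
      hin (fun x hx _ => by omega) hK
    rwa [show i - k * C + k * C = i by omega] at this
  | secondary v s q hs hsC hq hqk hF hv hK ih =>
    have hvn := (hF v ⟨by omega, le_rfl⟩).lt
    have hqC := Nat.mul_le_mul_right C hqk
    have hCk := Nat.mul_le_mul_right C (hq.trans hqk)
    have := hP.not_isPartEnd (b := v - k * C) (d := k - q) (w := v - s + 1) (by omega)
      (by omega) (by omega) (by omega) (fun x hx hend => ?_) hK
    · rwa [Nat.sub_mul, show v - k * C + (k * C - q * C) = v - q * C by omega] at this
    · by_contra hlt
      exact ih x ⟨by omega, by omega⟩ hend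

/-- If no `C` consecutive vertices are forbidden and `y` is not forbidden, then a run of forbidden
vertices ending in `y + C` is carried along by translations by multiples of `C`. -/
theorem forbidden_add_mul {n : ℕ} {G : SimpleGraph ℕ} {C k : ℕ}
    (hno : ∀ a, ∃ w, a ≤ w ∧ w < a + C ∧ ¬ Forbidden n G C k w) {y t : ℕ}
    (hy : ¬ Forbidden n G C k y) (htC : t ≤ C) (ht : ∀ j < t, Forbidden n G C k (y + C - j))
    {j p : ℕ} (hj : j < t) (hp : p ≤ k) : Forbidden n G C k (y + C - j + p * C) := by
  rcases Nat.eq_zero_or_pos k with hk | hk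
  · obtain rfl : p = 0 := by omega
    simpa using ht j hj
  induction j using Nat.strong_induction_on generalizing p with
  | _ j ih =>
  have hF := ht j hj
  generalize hz : y + C - j = z at hF ⊢
  cases hF with
  | primary _ hz1 hzn hK =>
    refine absurd ?_ hy
    have hrun : ∀ w, y + C - j ≤ w → w ≤ y + C → Forbidden n G C k w := by
      intro w h1 h2
      have := ht (y + C - w) (by omega)
      rwa [show y + C - (y + C - w) = w by omega] at this
    have hjC : j + 1 + 1 ≤ C := by
      by_contra hlt
      obtain ⟨w, h1, h2, h3⟩ := hno (y + 1)
      exact h3 (hrun w (by omega) (by omega))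
    have := Forbidden.secondary (n := n) (G := G) (k := k) (y + C) (j + 1) 1 (by omega) hjC le_rfl
      hk (fun w hw => hrun w (by have := hw.1; omega) hw.2) (by omega)
      (hK.subset (Set.Icc_subset_Icc (by omega) (by omega)))
    simpa using this
  | secondary v s q hs hsC hq hqk hF hv hK =>
    have hqC := Nat.mul_le_mul_right C hqk
    rcases hqk.eq_or_lt with rfl | hqk
    · rcases hp.eq_or_lt with rfl | hp
      · rw [Nat.sub_add_cancel hv.le]
        exact hF v ⟨by omega, le_rfl⟩
      · have := Forbidden.secondary v s (q - p) hs hsC (by omega) (by omega) hF hv hK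
        have hpC := Nat.mul_le_mul_right C hp.le
        rwa [Nat.sub_mul, show v - (q * C - p * C) = v - q * C + p * C by omega] at this
    · refine absurd ?_ hy
      have hv' : y + C + q * C = v + j := by omega
      have hrun : ∀ w, v - s + 1 ≤ w → w ≤ v + j → Forbidden n G C k w := by
        intro w h1 h2
        by_cases hwv : w ≤ v
        · exact hF w ⟨h1, hwv⟩
        · have := ih (v + j - w) (by omega) (by omega) (p := q) (by omega)
          rwa [show y + C - (v + j - w) + q * C = w by omega] at this
      have hsj : s + j + 1 ≤ C := by
        by_contra hlt
        obtain ⟨w, h1, h2, h3⟩ := hno (v + j + 1 - C)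
        have := Nat.mul_le_mul_right C hk
        exact h3 (hrun w (by omega) (by omega))
      have := Forbidden.secondary (n := n) (G := G) (k := k) (v + j) (s + j) (q + 1) (by omega)
        hsj (by omega) hqk (fun w hw => hrun w (by have := hw.1; omega) hw.2) (by omega)
        (hK.subset (Set.Icc_subset_Icc (by omega) (by omega)))
      rwa [Nat.succ_mul, ← hv', show y + C + q * C - (q * C + C) = y by omega] at this

/-- `e` lists the ends of the parts chosen greedily from left to right: each end is the largest
vertex at distance at most `C` from the previous one that does not satisfy `F`. -/
structure IsGreedy (F : ℕ → Prop) (C : ℕ) (e : ℕ → ℕ) : Prop where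
  zero : e 0 = 0
  lt_succ : ∀ i, e i < e (i + 1)
  succ_le : ∀ i, e (i + 1) ≤ e i + C
  not_succ : ∀ i, ¬ F (e (i + 1))
  of_lt : ∀ i w, e (i + 1) < w → w ≤ e i + C → F w

theorem exists_isGreedy {F : ℕ → Prop} {C : ℕ} (hno : ∀ a, ∃ w, a ≤ w ∧ w < a + C ∧ ¬ F w) :
    ∃ e, IsGreedy F C e := by
  classical
  have hnext : ∀ x, ∃ y, x < y ∧ y ≤ x + C ∧ ¬ F y ∧ ∀ w, y < w → w ≤ x + C → F w := by
    intro x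
    obtain ⟨w, h1, h2, h3⟩ := hno (x + 1)
    have hw : w ≤ x + C := by omega
    have hle := Nat.le_findGreatest (P := fun m => ¬ F m) hw h3
    refine ⟨Nat.findGreatest (fun m => ¬ F m) (x + C), by omega, Nat.findGreatest_le _,
      Nat.findGreatest_spec (P := fun m => ¬ F m) hw h3, fun v hv1 hv2 => ?_⟩
    exact not_not.1 (Nat.findGreatest_is_greatest hv1 hv2)
  choose g h1 h2 h3 h4 using hnext
  refine ⟨fun i => g^[i] 0, rfl, ?_, ?_, ?_, ?_⟩ <;> intro i <;>
    simp only [Function.iterate_succ_apply']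
  exacts [h1 _, h2 _, h3 _, h4 _]

theorem IsGreedy.not_isClique {n : ℕ} {G : SimpleGraph ℕ} {C k : ℕ} {e : ℕ → ℕ}
    (he : IsGreedy (Forbidden n G C k) C e)
    (hno : ∀ a, ∃ w, a ≤ w ∧ w < a + C ∧ ¬ Forbidden n G C k w) {m : ℕ}
    (hn : e (m + 1 + k) + 1 ≤ n) :
    ¬ G.IsClique (Set.Icc (e (m + 1)) (e (m + 1 + k) + 1)) := by
  intro hK
  have hpos : 0 < e (m + 1) := (Nat.zero_le _).trans_lt (he.lt_succ m)
  have key : ∀ i l, i + l = k → e (m + 1 + i) ≤ e (m + 1) + i * C ∧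
      ∀ w, e (m + 1 + i) + l * C < w → w ≤ e (m + 1) + k * C → Forbidden n G C k w := by
    intro i
    induction i with
    | zero =>
      intro l hl
      obtain rfl : l = k := by omega
      exact ⟨by simp, fun w h1 h2 => by simp only [add_zero] at h1; omega⟩
    | succ i ih =>
      intro l hl
      obtain ⟨h1, h2⟩ := ih (l + 1) (by omega)
      have hle := he.succ_le (m + 1 + i)
      have hlt := he.lt_succ (m + 1 + i)
      rw [Nat.succ_mul] at *
      rw [← add_assoc]
      refine ⟨by omega, fun w hw1 hw2 => ?_⟩
      by_cases hw : e (m + 1 + i) + (l * C + C) < w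
      · exact h2 w hw hw2
      · have hy : ¬ Forbidden n G C k (e (m + 1 + i)) := by
          rw [show m + 1 + i = m + i + 1 by omega]; exact he.not_succ _
        have := forbidden_add_mul hno hy
          (t := e (m + 1 + i) + C - e (m + 1 + i + 1)) (by omega)
          (fun j hj => he.of_lt (m + 1 + i) _ (by omega) (by omega))
          (j := e (m + 1 + i) + C - (w - l * C)) (p := l) (by omega) (by omega)
        rwa [show e (m + 1 + i) + C - (e (m + 1 + i) + C - (w - l * C)) + l * C = w by omega]
          at this
  obtain ⟨hle, hF⟩ := key k 0 rfl
  simp only [zero_mul, add_zero] at hF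
  rcases hle.eq_or_lt with heq | hlt
  · have hne : ¬ Forbidden n G C k (e (m + 1 + k)) := by
      rw [show m + 1 + k = m + k + 1 by omega]; exact he.not_succ _
    refine hne (.primary _ (by omega) hn ?_)
    rwa [show e (m + 1 + k) - k * C = e (m + 1) by omega]
  · have hk : 1 ≤ k := by
      by_contra hk
      obtain rfl : k = 0 := by omega
      simp at hlt
    have hCk := Nat.mul_le_mul_right C hk
    have hsC : e (m + 1) + k * C - e (m + 1 + k) + 1 ≤ C := by
      by_contra hlt
      obtain ⟨w, h1, h2, h3⟩ := hno (e (m + 1) + k * C + 1 - C)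
      exact h3 (hF w (by omega) (by omega))
    have := Forbidden.secondary (n := n) (G := G) (k := k) (e (m + 1) + k * C)
      (e (m + 1) + k * C - e (m + 1 + k)) k (by omega) hsC hk le_rfl
      (fun w hw => hF w (by have := hw.1; omega) hw.2) (by omega)
      (by rwa [Nat.add_sub_cancel, show e (m + 1) + k * C -
        (e (m + 1) + k * C - e (m + 1 + k)) + 1 = e (m + 1 + k) + 1 by omega])
    rw [Nat.add_sub_cancel] at this
    exact he.not_succ m this

theorem IsGreedy.exists_blockPartition {n : ℕ} {G : SimpleGraph ℕ} {C k : ℕ} {e : ℕ → ℕ}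
    (humb : Umbrella G) (hconn : ConnectedOn n G)
    (he : IsGreedy (Forbidden n G C k) C e)
    (hno : ∀ a, ∃ w, a ≤ w ∧ w < a + C ∧ ¬ Forbidden n G C k w) :
    ∃ Ps : Set (Set ℕ), IsLCBlockPartition n G (k + 1) C Ps := by
  have hmono : StrictMono e := strictMono_nat_of_lt_succ he.lt_succ
  let P : ℕ → Set ℕ := fun j => Set.Icc (e j + 1) (min (e (j + 1)) n)
  have hPmem : ∀ j x, x ∈ P j ↔ e j < x ∧ x ≤ e (j + 1) ∧ x ≤ n := by
    intro j x
    simp only [P, Set.mem_Icc, le_min_iff, Nat.succ_le_iff]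
  refine ⟨{S | S.Nonempty ∧ ∃ j, S = P j}, ⟨⟨fun S hS => hS.1, ?_, ?_⟩, ?_, ?_⟩, ?_⟩
  · rintro _ ⟨-, i, rfl⟩ _ ⟨-, j, rfl⟩ hne
    refine Set.disjoint_left.2 fun x hxi hxj => hne ?_
    rw [id, hPmem] at hxi hxj
    have h1 : i < j + 1 := hmono.lt_iff_lt.1 (hxi.1.trans_le hxj.2.1)
    have h2 : j < i + 1 := hmono.lt_iff_lt.1 (hxj.1.trans_le hxi.2.1)
    rw [show i = j by omega]
  · ext x
    constructor
    · rintro ⟨_, ⟨-, j, rfl⟩, hx⟩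
      rw [hPmem] at hx
      exact ⟨by omega, hx.2.2⟩
    · rintro ⟨hx1, hxn⟩
      have hex : ∃ j, x ≤ e j := ⟨x, hmono.le_apply⟩
      classical
      obtain ⟨j, hj⟩ : ∃ j, Nat.find hex = j + 1 := by
        refine Nat.exists_eq_succ_of_ne_zero fun h0 => ?_
        have := Nat.find_spec hex
        rw [h0, he.zero] at this
        omega
      have h1 := Nat.find_spec hex
      have h2 := Nat.find_min hex (m := j) (by omega)
      rw [hj] at h1
      have hx : x ∈ P j := (hPmem j x).2 ⟨by omega, h1, hxn⟩
      exact ⟨P j, ⟨⟨x, hx⟩, j, rfl⟩, hx⟩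
  · rintro _ ⟨-, j, rfl⟩
    constructor
    · exact connectedIn_Icc fun i h1 h2 => hconn.adj_succ humb (by omega) (by omega)
    · have := he.succ_le j
      simp only [P]
      rw [← Finset.coe_Icc, Set.ncard_coe_finset, Nat.card_Icc]
      omega
  · intro K hK
    by_cases hex : ∃ j, (P j ∩ K).Nonempty
    · classical
      obtain ⟨u, hu, huK⟩ := Nat.find_spec hex
      have hmin := fun j => Nat.find_min' hex (m := j)
      set a := Nat.find hex
      have hsub : {S ∈ {S | S.Nonempty ∧ ∃ j, S = P j} | (S ∩ K).Nonempty} ⊆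
          P '' (Finset.Icc a (a + k) : Set ℕ) := by
        rintro _ ⟨⟨-, b, rfl⟩, hne⟩
        refine ⟨b, ?_, rfl⟩
        rw [Finset.coe_Icc]
        refine ⟨hmin b hne, ?_⟩
        by_contra! hab
        obtain ⟨w, hw, hwK⟩ := hne
        rw [hPmem] at hu hw
        have h1 : e (a + 1 + k) ≤ e b := hmono.monotone (by omega)
        have h2 : e (a + 1) ≤ e (a + 1 + k) := hmono.monotone (by omega)
        have hadj := hK huK hwK (by omega)
        exact he.not_isClique hno (m := a) (by omega) ((humb.isClique_Icc hadj).subset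
          (Set.Icc_subset_Icc (by omega) (by omega)))
      calc _ ≤ (P '' (Finset.Icc a (a + k) : Set ℕ)).ncard :=
            Set.ncard_le_ncard hsub ((Finset.finite_toSet _).image _)
        _ ≤ (Finset.Icc a (a + k) : Set ℕ).ncard := Set.ncard_image_le (Finset.finite_toSet _)
        _ = k + 1 := by rw [Set.ncard_coe_finset, Nat.card_Icc]; omega
    · have hempty : {S ∈ {S | S.Nonempty ∧ ∃ j, S = P j} | (S ∩ K).Nonempty} = ∅ := by
        refine Set.eq_empty_of_forall_notMem ?_
        rintro _ ⟨⟨-, j, rfl⟩, hne⟩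
        exact hex ⟨j, hne⟩
      rw [hempty, Set.ncard_empty]
      exact Nat.zero_le _
  · rintro _ ⟨⟨x, hx⟩, j, rfl⟩
    rw [hPmem] at hx
    exact ⟨e j + 1, min (e (j + 1)) n, by omega, by omega, rfl⟩

/-- for a connected proper interval graph with `ω(G) = kC + r`,
`2 ≤ r ≤ C`, there is a `[k+1,C]`-block partition iff no `C` consecutive vertices
of `{1,…,n}` are all forbidden. -/
theorem blockPartition_iff_no_forbidden_block (n : ℕ) (G : SimpleGraph ℕ)
    (hrange : OnRange n G) (humb : Umbrella G) (hconn : ConnectedOn n G)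
    (hn : 0 < n) (C k r : ℕ) (hC : 0 < C)
    (hk : k = (cliqueNumber G - 1) / C) (hr2 : 2 ≤ r) (hrC : r ≤ C)
    (homega : cliqueNumber G = k * C + r) :
    (∃ Ps : Set (Set ℕ), IsLCBlockPartition n G (k + 1) C Ps) ↔
      ¬ ∃ a : ℕ, 1 ≤ a ∧ a + C - 1 ≤ n ∧
        ∀ w ∈ Set.Icc a (a + C - 1), Forbidden n G C k w := by
  constructor
  · rintro ⟨Ps, hP⟩ ⟨a, ha, han, hF⟩
    obtain ⟨x, hax, hxa, hx⟩ := hP.exists_isPartEnd ha (by omega)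
    exact (hF x ⟨hax, by omega⟩).not_isPartEnd hP hx
  · intro h
    have hno : ∀ a, ∃ w, a ≤ w ∧ w < a + C ∧ ¬ Forbidden n G C k w := by
      intro a
      by_contra! hF
      have hlast := (hF (a + C - 1) (by omega) (by omega)).lt
      have hpos := (hF a le_rfl (by omega)).pos
      exact h ⟨a, hpos, hlast.le, fun w hw => hF w hw.1 (by have := hw.2; omega)⟩
    obtain ⟨e, he⟩ := exists_isGreedy hno
    exact he.exists_blockPartition humb hconn hno
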